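/- Let V be a compact subset of ℝ^d, let Σ : ℝ^d × V → ℝ be bounded and continuous with Σ(y,v) ≥ Σ₁ for all (y,v) and some constant Σ₁ > 0, let a : V → ℝ^d be bounded, and let h : ℝ^d × V → ℝ be bounded and continuous in y for each v. Then f(y,v) := ∫₀^∞ exp( −∫₀^s Σ(y − a(v)τ, v) dτ ) h(y − a(v)s, v) ds defines a bounded function such that, for each v ∈ V: (a) f(·,v) satisfies the transport equation a(v)·∇_y f(·,v) + Σ(·,v) f(·,v) = h(·,v) in the sense of distributions on ℝ^d; (b) if h ≥ 0 then f ≥ 0, and if h > 0 then f > 0; (c) limsup_{R→∞} ⨍_{B_R} |f(y,v)|² dy ≤ Σ₁^{−2} · limsup_{R→∞} ⨍_{B_R} |h(y,v)|² dy. -/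

import Mathlib

open MeasureTheory Filter Topology

noncomputable section

/-- Euclidean space `ℝ^d`. -/
abbrev E (d : ℕ) := EuclideanSpace ℝ (Fin d)

/-- Average of a function over the ball of radius `R` centered at the origin. -/
noncomputable def ballAvg {d : ℕ} (u : E d → ℝ) (R : ℝ) : ℝ :=
  ⨍ y in Metric.ball (0 : E d) R, u y

/-- `u` has mean value `m` : the ball averages converge to `m` as `R → ∞`. -/
def HasMeanValue {d : ℕ} (u : E d → ℝ) (m : ℝ) : Prop :=
  Tendsto (ballAvg u) atTop (𝓝 m)

/-- The mean value `M(u)` (junk value if the limit does not exist). -/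
noncomputable def meanValue {d : ℕ} (u : E d → ℝ) : ℝ :=
  limUnder atTop (ballAvg u)

/-- An algebra with mean value on `ℝ^d`: a closed subalgebra of BUC(ℝ^d) containing the
constants, translation invariant, all of whose elements possess a mean value. -/
structure AlgebraWMV (d : ℕ) where
  carrier : Set (E d → ℝ)
  bdd : ∀ u ∈ carrier, ∃ C : ℝ, ∀ x, |u x| ≤ C
  uc : ∀ u ∈ carrier, UniformContinuous u
  const_mem : ∀ c : ℝ, (fun _ => c) ∈ carrier
  add_mem : ∀ u ∈ carrier, ∀ v ∈ carrier, u + v ∈ carrier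
  mul_mem : ∀ u ∈ carrier, ∀ v ∈ carrier, u * v ∈ carrier
  smul_mem : ∀ (c : ℝ), ∀ u ∈ carrier, c • u ∈ carrier
  translate_mem : ∀ u ∈ carrier, ∀ a : E d, (fun x => u (x + a)) ∈ carrier
  closed' : ∀ (u : E d → ℝ) (g : ℕ → E d → ℝ), (∀ n, g n ∈ carrier) →
      TendstoUniformly g u atTop → u ∈ carrier
  mean_exists : ∀ u ∈ carrier, ∃ m : ℝ, HasMeanValue u m

/-- The Duhamel formula along characteristics for the advection operator
`a(v)·∇_y + Σ`. -/
noncomputable def duhamel {d : ℕ} (S : E d → E d → ℝ) (a : E d → E d)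
    (h : E d → E d → ℝ) (y v : E d) : ℝ :=
  ∫ s in Set.Ioi (0:ℝ),
    Real.exp (-∫ τ in Set.Ioo (0:ℝ) s, S (y - τ • a v) v) * h (y - s • a v) v

section Characteristics

variable {F : Type*} [NormedAddCommGroup F] [NormedSpace ℝ F]

/-- The integral of `σ` along the backward characteristic of direction `b` issued from `y`. -/
def opticalDepth (σ : F → ℝ) (b y : F) (s : ℝ) : ℝ := ∫ τ in (0:ℝ)..s, σ (y - τ • b)

/-- The Duhamel formula for the constant-coefficient advection operator `b·∇ + σ`. -/
def charSol (σ g : F → ℝ) (b y : F) : ℝ :=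
  ∫ s in Set.Ioi (0:ℝ), Real.exp (-opticalDepth σ b y s) * g (y - s • b)

theorem duhamel_eq_charSol {d : ℕ} (S : E d → E d → ℝ) (a : E d → E d)
    (h : E d → E d → ℝ) (y v : E d) :
    duhamel S a h y v = charSol (fun y => S y v) (fun y => h y v) (a v) y := by
  refine setIntegral_congr_fun measurableSet_Ioi fun s hs => ?_
  simp only [opticalDepth]
  rw [intervalIntegral.integral_of_le (le_of_lt hs), integral_Ioc_eq_integral_Ioo]

variable {σ g : F → ℝ} {b : F} {c C : ℝ}

theorem continuous_opticalDepth (hσ : Continuous σ) :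
    Continuous fun p : F × ℝ => opticalDepth σ b p.1 p.2 := by
  unfold opticalDepth
  exact intervalIntegral.continuous_parametric_intervalIntegral_of_continuous
    (f := fun (p : F × ℝ) τ => σ (p.1 - τ • b)) (by fun_prop) continuous_snd

theorem mul_le_opticalDepth (hσ : Continuous σ) (hc : ∀ y, c ≤ σ y) (y : F) {s : ℝ}
    (hs : 0 ≤ s) : c * s ≤ opticalDepth σ b y s := by
  have h := intervalIntegral.integral_mono_on (μ := volume) (f := fun _ => c)
    (g := fun τ => σ (y - τ • b)) hs (by simp)
    (Continuous.intervalIntegrable (by fun_prop) _ _) (fun x _ => hc _)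
  simpa [opticalDepth, mul_comm] using h

theorem continuous_charSol_integrand (hσ : Continuous σ) (hg : Continuous g) :
    Continuous fun p : F × ℝ =>
      Real.exp (-opticalDepth σ b p.1 p.2) * g (p.1 - p.2 • b) :=
  (Real.continuous_exp.comp (continuous_opticalDepth hσ).neg).mul (by fun_prop)

theorem abs_charSol_integrand_le (hσ : Continuous σ) (hc : ∀ y, c ≤ σ y) (y : F) {s : ℝ}
    (hs : 0 ≤ s) :
    |Real.exp (-opticalDepth σ b y s) * g (y - s • b)| ≤
      Real.exp (-c * s) * |g (y - s • b)| := by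
  rw [abs_mul, Real.abs_exp]
  gcongr
  linarith [mul_le_opticalDepth (b := b) hσ hc y hs]

theorem integrableOn_exp_mul_of_bounded (hc0 : 0 < c) {u : ℝ → ℝ} (hu : Measurable u)
    (hC : ∀ s, |u s| ≤ C) :
    IntegrableOn (fun s => Real.exp (-c * s) * u s) (Set.Ioi 0) :=
  (exp_neg_integrableOn_Ioi 0 hc0).mul_bdd hu.aestronglyMeasurable
    (Eventually.of_forall hC)

theorem integral_exp_neg_mul (hc0 : 0 < c) :
    ∫ s in Set.Ioi (0:ℝ), Real.exp (-c * s) = c⁻¹ := by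
  rw [integral_exp_mul_Ioi (by linarith)]
  simp

theorem ae_abs_charSol_integrand_le (hσ : Continuous σ) (hc : ∀ y, c ≤ σ y)
    (hC : ∀ y, |g y| ≤ C) (y : F) :
    ∀ᵐ s ∂volume.restrict (Set.Ioi (0:ℝ)),
      ‖Real.exp (-opticalDepth σ b y s) * g (y - s • b)‖ ≤ Real.exp (-c * s) * C := by
  filter_upwards [ae_restrict_mem measurableSet_Ioi] with s hs
  refine (abs_charSol_integrand_le hσ hc y (le_of_lt hs)).trans ?_
  gcongr
  exact hC _

theorem integrableOn_charSol_integrand (hσ : Continuous σ) (hc0 : 0 < c) (hc : ∀ y, c ≤ σ y)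
    (hg : Continuous g) (hC : ∀ y, |g y| ≤ C) (y : F) :
    IntegrableOn (fun s => Real.exp (-opticalDepth σ b y s) * g (y - s • b)) (Set.Ioi 0) :=
  ((exp_neg_integrableOn_Ioi 0 hc0).mul_const C).mono'
    ((continuous_charSol_integrand hσ hg).comp
      (Continuous.prodMk_right y)).aestronglyMeasurable
    (ae_abs_charSol_integrand_le hσ hc hC y)

theorem abs_charSol_le_integral (hσ : Continuous σ) (hc0 : 0 < c) (hc : ∀ y, c ≤ σ y)
    (hg : Continuous g) (hC : ∀ y, |g y| ≤ C) (y : F) :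
    |charSol σ g b y| ≤ ∫ s in Set.Ioi (0:ℝ), Real.exp (-c * s) * |g (y - s • b)| := by
  refine norm_integral_le_of_norm_le (f := fun s =>
    Real.exp (-opticalDepth σ b y s) * g (y - s • b)) ?_ ?_
  · exact integrableOn_exp_mul_of_bounded (C := C) hc0
      (Continuous.measurable (by fun_prop)) (fun s => by simpa using hC _)
  · filter_upwards [ae_restrict_mem measurableSet_Ioi] with s hs
    exact abs_charSol_integrand_le hσ hc y (le_of_lt hs)

theorem abs_charSol_le (hσ : Continuous σ) (hc0 : 0 < c) (hc : ∀ y, c ≤ σ y)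
    (hC : ∀ y, |g y| ≤ C) (y : F) : |charSol σ g b y| ≤ c⁻¹ * C := by
  have h := norm_integral_le_of_norm_le ((exp_neg_integrableOn_Ioi 0 hc0).mul_const C)
    (ae_abs_charSol_integrand_le (b := b) hσ hc hC y)
  rwa [integral_mul_const, integral_exp_neg_mul hc0] at h

theorem continuous_charSol (hσ : Continuous σ) (hc0 : 0 < c) (hc : ∀ y, c ≤ σ y)
    (hg : Continuous g) (hC : ∀ y, |g y| ≤ C) : Continuous (charSol σ g b) := by
  refine continuous_of_dominated (fun y => ?_) (ae_abs_charSol_integrand_le hσ hc hC)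
    ((exp_neg_integrableOn_Ioi 0 hc0).mul_const C) (Eventually.of_forall fun s => ?_)
  · exact ((continuous_charSol_integrand hσ hg).comp
      (Continuous.prodMk_right y)).aestronglyMeasurable
  · exact (continuous_charSol_integrand hσ hg).comp (Continuous.prodMk_left s)

theorem charSol_nonneg (hg : ∀ y, 0 ≤ g y) (y : F) : 0 ≤ charSol σ g b y :=
  integral_nonneg fun _ => mul_nonneg (Real.exp_pos _).le (hg _)

theorem charSol_pos (hσ : Continuous σ) (hc0 : 0 < c) (hc : ∀ y, c ≤ σ y)
    (hg : Continuous g) (hC : ∀ y, |g y| ≤ C) (hpos : ∀ y, 0 < g y) (y : F) :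
    0 < charSol σ g b y := by
  have hp : ∀ s, 0 < Real.exp (-opticalDepth σ b y s) * g (y - s • b) :=
    fun s => mul_pos (Real.exp_pos _) (hpos _)
  refine (setIntegral_pos_iff_support_of_nonneg_ae (Eventually.of_forall fun s => (hp s).le)
    (integrableOn_charSol_integrand hσ hc0 hc hg hC y)).2 ?_
  rw [Function.support_eq_univ fun s => (hp s).ne']
  simp

/-- Along a forward characteristic, the Duhamel formula is the variation-of-constants formula. -/
theorem charSol_add_smul (hσ : Continuous σ) (y : F) (t : ℝ) :
    charSol σ g b (y + t • b) = Real.exp (-∫ u in (0:ℝ)..t, σ (y + u • b)) *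
      ∫ r in Set.Iic t, Real.exp (∫ u in (0:ℝ)..r, σ (y + u • b)) * g (y + r • b) := by
  have hp : Continuous fun u : ℝ => σ (y + u • b) := by fun_prop
  have hi := fun p q => hp.intervalIntegrable (μ := volume) p q
  have key := (Measure.measurePreserving_sub_left volume t).setIntegral_preimage_emb
    (Homeomorph.subLeft t).measurableEmbedding
    (fun r => Real.exp (∫ u in (0:ℝ)..r, σ (y + u • b)) * g (y + r • b)) (Set.Iio t)
  have hset : (fun s => t - s) ⁻¹' Set.Iio t = Set.Ioi (0:ℝ) := by
    ext s; simp
  rw [hset] at key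
  rw [integral_Iic_eq_integral_Iio, ← key, ← integral_const_mul, charSol]
  congr 1 with s
  have hD : opticalDepth σ b (y + t • b) s =
      (∫ u in (0:ℝ)..t, σ (y + u • b)) - ∫ u in (0:ℝ)..(t - s), σ (y + u • b) := by
    rw [intervalIntegral.integral_interval_sub_left (hi _ _) (hi _ _)]
    have := intervalIntegral.integral_comp_sub_left (a := 0) (b := s)
      (fun u => σ (y + u • b)) t
    rw [sub_zero] at this
    rw [← this, opticalDepth]
    congr 1 with τ
    congr 1
    module
  have hy : y + t • b - s • b = y + (t - s) • b := by module
  rw [hD, hy, ← mul_assoc, ← Real.exp_add]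
  congr 2
  ring

theorem integrableOn_Iic_variation_of_constants (hσ : Continuous σ) (hc0 : 0 < c)
    (hc : ∀ y, c ≤ σ y) (hg : Continuous g) (hC : ∀ y, |g y| ≤ C) (y : F) (t : ℝ) :
    IntegrableOn (fun r => Real.exp (∫ u in (0:ℝ)..r, σ (y + u • b)) * g (y + r • b))
      (Set.Iic t) := by
  have hp : Continuous fun u : ℝ => σ (y + u • b) := by fun_prop
  have hi := fun p q => hp.intervalIntegrable (μ := volume) p q
  have hP : Continuous fun r => ∫ u in (0:ℝ)..r, σ (y + u • b) :=
    intervalIntegral.continuous_primitive hi 0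
  refine (((integrableOn_exp_mul_Iic hc0 t).const_mul
    (Real.exp ((∫ u in (0:ℝ)..t, σ (y + u • b)) - c * t))).mul_const C).mono'
    (Continuous.aestronglyMeasurable (by fun_prop)) ?_
  filter_upwards [ae_restrict_mem measurableSet_Iic] with r hr
  have hr : r ≤ t := hr
  have h1 := intervalIntegral.integral_mono_on (μ := volume) (f := fun _ => c) hr (by simp)
    (hi r t) (fun x _ => hc _)
  have h2 := intervalIntegral.integral_add_adjacent_intervals (hi 0 r) (hi r t)
  rw [intervalIntegral.integral_const, smul_eq_mul] at h1
  rw [Real.norm_eq_abs, abs_mul, Real.abs_exp, ← Real.exp_add]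
  gcongr
  · linarith
  · exact hC _

theorem hasLineDerivAt_charSol (hσ : Continuous σ) (hc0 : 0 < c) (hc : ∀ y, c ≤ σ y)
    (hg : Continuous g) (hC : ∀ y, |g y| ≤ C) (y : F) :
    HasLineDerivAt ℝ (charSol σ g b) (g y - σ y * charSol σ g b y) y b := by
  have hp : Continuous fun u : ℝ => σ (y + u • b) := by fun_prop
  have hP : ∀ t, HasDerivAt (fun r => ∫ u in (0:ℝ)..r, σ (y + u • b)) (σ (y + t • b)) t :=
    fun t => intervalIntegral.integral_hasDerivAt_right (hp.intervalIntegrable _ _)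
      (hp.stronglyMeasurableAtFilter _ _) hp.continuousAt
  have hPc : Continuous fun r => ∫ u in (0:ℝ)..r, σ (y + u • b) :=
    intervalIntegral.continuous_primitive (fun p q => hp.intervalIntegrable p q) 0
  set w : ℝ → ℝ := fun r => Real.exp (∫ u in (0:ℝ)..r, σ (y + u • b)) * g (y + r • b) with hw
  have hwc : Continuous w := by fun_prop
  have hwi := integrableOn_Iic_variation_of_constants (b := b) hσ hc0 hc hg hC y
  have hI : HasDerivAt (fun t => ∫ r in Set.Iic t, w r) (w 0) 0 := by
    have h1 : HasDerivAt (fun t => (∫ r in (0:ℝ)..t, w r) + ∫ r in Set.Iic 0, w r) (w 0) 0 :=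
      (intervalIntegral.integral_hasDerivAt_right (hwc.intervalIntegrable _ _)
        (hwc.stronglyMeasurableAtFilter _ _) hwc.continuousAt).add_const _
    convert h1 using 2 with t
    rw [← intervalIntegral.integral_Iic_sub_Iic (hwi 0) (hwi t)]
    ring
  have h0 := charSol_add_smul (g := g) (b := b) hσ y 0
  have hd := (hP 0).neg.exp.mul hI
  unfold HasLineDerivAt
  simp only [charSol_add_smul hσ]
  refine hd.congr_deriv ?_
  simp only [zero_smul, add_zero, intervalIntegral.integral_same, neg_zero, Real.exp_zero,
    one_mul] at h0
  rw [h0]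
  simp [hw]
  ring

theorem sq_charSol_le (hσ : Continuous σ) (hc0 : 0 < c) (hc : ∀ y, c ≤ σ y)
    (hg : Continuous g) (hC : ∀ y, |g y| ≤ C) (y : F) :
    charSol σ g b y ^ 2 ≤
      c⁻¹ * ∫ s in Set.Ioi (0:ℝ), Real.exp (-c * s) * g (y - s • b) ^ 2 := by
  set m := ∫ s in Set.Ioi (0:ℝ), Real.exp (-c * s) * |g (y - s • b)| with hm
  have h1 : IntegrableOn (fun s => Real.exp (-c * s) * |g (y - s • b)|) (Set.Ioi 0) :=
    integrableOn_exp_mul_of_bounded (C := C) hc0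
      (Continuous.measurable (by fun_prop)) (fun s => by simpa using hC _)
  have h2 : IntegrableOn (fun s => Real.exp (-c * s) * g (y - s • b) ^ 2) (Set.Ioi 0) :=
    integrableOn_exp_mul_of_bounded (C := C ^ 2) hc0
      (Continuous.measurable (by fun_prop)) (fun s => by
        rw [abs_pow]; gcongr; exact hC _)
  have h3 := exp_neg_integrableOn_Ioi 0 hc0
  have h4 : IntegrableOn (fun s => Real.exp (-c * s) * g (y - s • b) ^ 2
      - (2 * (c * m)) * (Real.exp (-c * s) * |g (y - s • b)|)) (Set.Ioi 0) :=
    h2.sub (h1.const_mul _)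
  have hexp : 0 ≤ ∫ s in Set.Ioi (0:ℝ),
      (Real.exp (-c * s) * g (y - s • b) ^ 2
        - (2 * (c * m)) * (Real.exp (-c * s) * |g (y - s • b)|)
        + (c * m) ^ 2 * Real.exp (-c * s)) := by
    refine integral_nonneg fun s => ?_
    have : 0 ≤ Real.exp (-c * s) * (|g (y - s • b)| - c * m) ^ 2 := by positivity
    refine this.trans (le_of_eq ?_)
    rw [← sq_abs (g (y - s • b))]
    ring
  rw [integral_add h4 (h3.const_mul _),
    integral_sub h2 (h1.const_mul _), integral_const_mul, integral_const_mul,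
    integral_exp_neg_mul hc0, ← hm] at hexp
  have hle := abs_charSol_le_integral (b := b) hσ hc0 hc hg hC y
  have hsq : charSol σ g b y ^ 2 ≤ m ^ 2 := by
    rw [← sq_abs]; gcongr
  have : (c * m) ^ 2 * c⁻¹ = c * m ^ 2 := by field_simp
  rw [this] at hexp
  rw [le_inv_mul_iff₀ hc0]
  nlinarith

variable [MeasurableSpace F] [BorelSpace F] [FiniteDimensional ℝ F]

theorem integral_charSol_weak {μ : Measure F} [μ.IsAddHaarMeasure]
    (hσ : Continuous σ) (hc0 : 0 < c) (hc : ∀ y, c ≤ σ y)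
    (hg : Continuous g) (hC : ∀ y, |g y| ≤ C) {φ : F → ℝ} (hφ : ContDiff ℝ 1 φ)
    (hφc : HasCompactSupport φ) :
    ∫ y, (-(charSol σ g b y) * fderiv ℝ φ y b
      + σ y * charSol σ g b y * φ y - g y * φ y) ∂μ = 0 := by
  have hf : Continuous (charSol σ g b) := continuous_charSol hσ hc0 hc hg hC
  have hdφ : Continuous fun y => fderiv ℝ φ y b :=
    (hφ.continuous_fderiv one_ne_zero).clm_apply continuous_const
  have hdφc : HasCompactSupport fun y => fderiv ℝ φ y b := hφc.fderiv_apply ℝ b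
  have i1 : Integrable (fun y => (g y - σ y * charSol σ g b y) * φ y) μ :=
    Continuous.integrable_of_hasCompactSupport
      ((hg.sub (hσ.mul hf)).mul hφ.continuous) hφc.mul_left
  have i2 : Integrable (fun y => charSol σ g b y * fderiv ℝ φ y b) μ :=
    (hf.mul hdφ).integrable_of_hasCompactSupport hdφc.mul_left
  have i3 : Integrable (fun y => charSol σ g b y * φ y) μ :=
    (hf.mul hφ.continuous).integrable_of_hasCompactSupport hφc.mul_left
  have key := integral_bilinear_hasLineDerivAt_right_eq_neg_left_of_integrable
    (B := ContinuousLinearMap.mul ℝ ℝ) (v := b) i1 i2 i3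
    (fun y _ => hasLineDerivAt_charSol hσ hc0 hc hg hC y)
    (fun y _ => ((hφ.differentiable one_ne_zero) y).hasFDerivAt.hasLineDerivAt b)
  simp only [ContinuousLinearMap.mul_apply'] at key
  calc _ = -∫ y, ((charSol σ g b y * fderiv ℝ φ y b)
          + (g y - σ y * charSol σ g b y) * φ y) ∂μ := by
        rw [← integral_neg]; congr 1 with y; ring
    _ = 0 := by rw [integral_add i2 i1, key]; ring

end Characteristics

section BallAverage

variable {d : ℕ} {G : E d → ℝ} {M c : ℝ}

theorem ballAvg_eq (u : E d → ℝ) (R : ℝ) :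
    ballAvg u R = (volume.real (Metric.ball (0 : E d) R))⁻¹ * ∫ y in Metric.ball 0 R, u y := by
  rw [ballAvg, setAverage_eq, smul_eq_mul]

theorem volume_real_ball_zero {R : ℝ} (hR : 0 < R) :
    volume.real (Metric.ball (0 : E d) R) = R ^ d * volume.real (Metric.ball (0 : E d) 1) := by
  rw [measureReal_def, Measure.addHaar_ball_of_pos _ _ hR, ENNReal.toReal_mul,
    ENNReal.toReal_ofReal (by positivity), finrank_euclideanSpace_fin, measureReal_def]

theorem volume_real_ball_pos {R : ℝ} (hR : 0 < R) :
    0 < volume.real (Metric.ball (0 : E d) R) :=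
  ENNReal.toReal_pos (Metric.measure_ball_pos _ _ hR).ne' measure_ball_lt_top.ne

theorem integrableOn_ball (hG : Continuous G) (x : E d) (R : ℝ) :
    IntegrableOn G (Metric.ball x R) :=
  (hG.continuousOn.integrableOn_compact (isCompact_closedBall x R)).mono_set
    Metric.ball_subset_closedBall

theorem ballAvg_mono {u w : E d → ℝ} (hu : Continuous u) (hw : Continuous w)
    (huw : ∀ y, u y ≤ w y) (R : ℝ) : ballAvg u R ≤ ballAvg w R := by
  rw [ballAvg_eq, ballAvg_eq]
  gcongr
  · exact integrableOn_ball hu 0 R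
  · exact integrableOn_ball hw 0 R
  · exact measurableSet_ball.nullMeasurableSet
  · exact huw _

theorem ballAvg_nonneg (h0 : ∀ y, 0 ≤ G y) (R : ℝ) : 0 ≤ ballAvg G R := by
  rw [ballAvg_eq]
  exact mul_nonneg (by positivity) (integral_nonneg fun y => h0 y)

theorem ballAvg_le_of_le (hG : Continuous G) (hM : ∀ y, G y ≤ M) {R : ℝ} (hR : 0 < R) :
    ballAvg G R ≤ M := by
  refine (ballAvg_mono hG continuous_const hM R).trans (le_of_eq ?_)
  have := (volume_real_ball_pos (d := d) hR).ne'
  rw [ballAvg_eq, setIntegral_const, smul_eq_mul]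
  field_simp

theorem ballAvg_translate_le (hG : Continuous G) (h0 : ∀ y, 0 ≤ G y) (x : E d) {R : ℝ}
    (hR : 0 < R) :
    ballAvg (fun y => G (y - x)) R ≤ ((R + ‖x‖) / R) ^ d * ballAvg G (R + ‖x‖) := by
  have hR' : 0 < R + ‖x‖ := by positivity
  have h1 : ∫ y in Metric.ball 0 R, G (y - x) ≤ ∫ y in Metric.ball 0 (R + ‖x‖), G y := by
    have := (measurePreserving_sub_right volume x).setIntegral_preimage_emb
      (Homeomorph.subRight x).measurableEmbedding G (Metric.ball 0 (R + ‖x‖))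
    rw [← this]
    refine setIntegral_mono_set ?_ (Eventually.of_forall fun y => h0 _)
      (LE.le.eventuallyLE ?_)
    · have hs : (fun y => y - x) ⁻¹' Metric.ball 0 (R + ‖x‖) = Metric.ball x (R + ‖x‖) := by
        ext y; simp [dist_eq_norm]
      rw [hs]
      exact integrableOn_ball (by fun_prop) _ _
    · intro y hy
      simp only [Metric.mem_ball, dist_zero_right, Set.mem_preimage] at hy ⊢
      linarith [norm_sub_le y x]
  have hv := volume_real_ball_pos (d := d) one_pos
  rw [ballAvg_eq, ballAvg_eq, volume_real_ball_zero hR, volume_real_ball_zero hR']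
  calc _ ≤ (R ^ d * volume.real (Metric.ball (0 : E d) 1))⁻¹ *
        ∫ y in Metric.ball 0 (R + ‖x‖), G y := by gcongr
    _ = _ := by
      rw [div_pow]
      field_simp

theorem integrable_exp_mul_translate (hG : Continuous G) (hc0 : 0 < c)
    (hM : ∀ y, |G y| ≤ M) (b : E d) (R : ℝ) :
    Integrable (Function.uncurry fun (y : E d) (s : ℝ) => Real.exp (-c * s) * G (y - s • b))
      ((volume.restrict (Metric.ball 0 R)).prod (volume.restrict (Set.Ioi 0))) := by
  have : IsFiniteMeasure (volume.restrict (Metric.ball (0 : E d) R)) :=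
    ⟨by simpa using measure_ball_lt_top⟩
  refine ((integrable_const M).mul_prod (exp_neg_integrableOn_Ioi 0 hc0)).mono'
    (Continuous.aestronglyMeasurable (by unfold Function.uncurry; fun_prop))
    (Eventually.of_forall fun p => ?_)
  simp only [Function.uncurry, Real.norm_eq_abs, abs_mul, Real.abs_exp]
  rw [mul_comm]
  gcongr
  exact hM _

theorem ballAvg_integral_translate (hG : Continuous G) (hc0 : 0 < c)
    (hM : ∀ y, |G y| ≤ M) (b : E d) (R : ℝ) :
    ballAvg (fun y => ∫ s in Set.Ioi (0:ℝ), Real.exp (-c * s) * G (y - s • b)) R =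
      ∫ s in Set.Ioi (0:ℝ), Real.exp (-c * s) * ballAvg (fun y => G (y - s • b)) R := by
  rw [ballAvg_eq, integral_integral_swap (integrable_exp_mul_translate hG hc0 hM b R),
    ← integral_const_mul]
  congr 1 with s
  rw [integral_const_mul, ballAvg_eq]
  ring

theorem ballAvg_integral_translate_le (hG : Continuous G) (hc0 : 0 < c)
    (h0 : ∀ y, 0 ≤ G y) (hM : ∀ y, G y ≤ M) (b : E d) {L R : ℝ} (hL : 0 ≤ L) (hR : 0 < R)
    (hLR : ∀ r ≥ R, ballAvg G r ≤ L) :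
    ballAvg (fun y => ∫ s in Set.Ioi (0:ℝ), Real.exp (-c * s) * G (y - s • b)) R ≤
      ∫ s in Set.Ioi (0:ℝ), Real.exp (-c * s) * min M (((R + |s| * ‖b‖) / R) ^ d * L) := by
  have hM0 : 0 ≤ M := (h0 0).trans (hM 0)
  rw [ballAvg_integral_translate hG hc0 (fun y => by rw [abs_of_nonneg (h0 y)]; exact hM y)]
  refine integral_mono_of_nonneg (Eventually.of_forall fun s => ?_)
    (integrableOn_exp_mul_of_bounded (C := M) hc0 (Continuous.measurable (by fun_prop))
      fun s => ?_) (Eventually.of_forall fun s => ?_)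
  · exact mul_nonneg (Real.exp_pos _).le (ballAvg_nonneg (fun y => h0 _) R)
  · rw [abs_of_nonneg (le_min hM0 (by positivity))]
    exact min_le_left _ _
  · refine mul_le_mul_of_nonneg_left (le_min ?_ ?_) (Real.exp_pos _).le
    · exact ballAvg_le_of_le (by fun_prop) (fun y => hM _) hR
    · refine (ballAvg_translate_le hG h0 (s • b) hR).trans ?_
      rw [norm_smul, Real.norm_eq_abs]
      gcongr
      exact hLR _ (by simp only [ge_iff_le, le_add_iff_nonneg_right]; positivity)

theorem tendsto_integral_exp_min (hc0 : 0 < c) (hM0 : 0 ≤ M) (β : ℝ) (hβ : 0 ≤ β) {L : ℝ}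
    (hL : 0 ≤ L) :
    Tendsto (fun R : ℝ => ∫ s in Set.Ioi (0:ℝ),
      Real.exp (-c * s) * min M (((R + |s| * β) / R) ^ d * L)) atTop (𝓝 (c⁻¹ * min M L)) := by
  rw [← integral_exp_neg_mul hc0, ← integral_mul_const]
  refine tendsto_integral_filter_of_dominated_convergence (fun s => Real.exp (-c * s) * M)
    (Eventually.of_forall fun R => Continuous.aestronglyMeasurable (by fun_prop)) ?_
    ((exp_neg_integrableOn_Ioi 0 hc0).mul_const M) (Eventually.of_forall fun s => ?_)
  · filter_upwards [eventually_gt_atTop 0] with R hR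
    refine Eventually.of_forall fun s => ?_
    rw [Real.norm_eq_abs, abs_mul, Real.abs_exp, abs_of_nonneg (le_min hM0 (by positivity))]
    gcongr
    exact min_le_left _ _
  · have h1 : Tendsto (fun R : ℝ => (R + |s| * β) / R) atTop (𝓝 1) := by
      have h2 : Tendsto (fun R : ℝ => 1 + |s| * β / R) atTop (𝓝 (1 + 0)) :=
        tendsto_const_nhds.add (tendsto_const_nhds.div_atTop tendsto_id)
      rw [add_zero] at h2
      refine h2.congr' ?_
      filter_upwards [eventually_gt_atTop 0] with R hR
      field_simp
    have h3 := ((h1.pow d).mul_const L)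
    rw [one_pow, one_mul] at h3
    exact (tendsto_const_nhds.min h3).const_mul _

theorem limsup_ballAvg_le {u : E d → ℝ} (hu : Continuous u) (hu0 : ∀ y, 0 ≤ u y)
    (hG : Continuous G) (hc0 : 0 < c) (h0 : ∀ y, 0 ≤ G y) (hM : ∀ y, G y ≤ M) (b : E d)
    (huG : ∀ y, u y ≤ c⁻¹ * ∫ s in Set.Ioi (0:ℝ), Real.exp (-c * s) * G (y - s • b)) :
    limsup (ballAvg u) atTop ≤ (c ^ 2)⁻¹ * limsup (ballAvg G) atTop := by
  have hM0 : 0 ≤ M := (h0 0).trans (hM 0)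
  have hbdd : IsBoundedUnder (· ≤ ·) atTop (ballAvg G) :=
    isBoundedUnder_of_eventually_le
      ((eventually_gt_atTop 0).mono fun R hR => ballAvg_le_of_le hG hM hR)
  have hcob : IsCoboundedUnder (· ≤ ·) atTop (ballAvg u) :=
    (isBoundedUnder_of (r := (· ≥ ·)) ⟨0, fun R => ballAvg_nonneg hu0 R⟩).isCoboundedUnder_flip
  set L := limsup (ballAvg G) atTop with hLdef
  have hL0 : 0 ≤ L :=
    le_limsup_of_frequently_le (Frequently.of_forall fun R => ballAvg_nonneg h0 R) hbdd
  have hW : Continuous fun y => ∫ s in Set.Ioi (0:ℝ), Real.exp (-c * s) * G (y - s • b) := by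
    refine continuous_of_dominated (bound := fun s => Real.exp (-c * s) * M)
      (fun y => Continuous.aestronglyMeasurable (by fun_prop))
      (fun y => Eventually.of_forall fun s => ?_)
      ((exp_neg_integrableOn_Ioi 0 hc0).mul_const M)
      (Eventually.of_forall fun s => by fun_prop)
    rw [Real.norm_eq_abs, abs_mul, Real.abs_exp, abs_of_nonneg (h0 _)]
    gcongr
    exact hM _
  have main : ∀ K > L, limsup (ballAvg u) atTop ≤ (c ^ 2)⁻¹ * K := by
    intro K hK
    have hK0 : 0 ≤ K := hL0.trans hK.le
    obtain ⟨R₀, hR₀⟩ := eventually_atTop.1 (eventually_lt_of_limsup_lt hK hbdd)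
    have hlim := (tendsto_integral_exp_min (d := d) hc0 hM0 ‖b‖ (norm_nonneg b)
      hK0).const_mul c⁻¹
    calc limsup (ballAvg u) atTop ≤ _ := limsup_le_limsup ?_ hcob hlim.isBoundedUnder_le
      _ = _ := hlim.limsup_eq
      _ ≤ c⁻¹ * (c⁻¹ * K) := by gcongr; exact min_le_right _ _
      _ = _ := by rw [sq, mul_inv, mul_assoc]
    filter_upwards [eventually_gt_atTop 0, eventually_ge_atTop R₀] with R hR hRR
    refine (ballAvg_mono hu (hW.const_mul c⁻¹) huG R).trans ?_
    have : ballAvg (fun y => c⁻¹ * ∫ s in Set.Ioi (0:ℝ), Real.exp (-c * s) * G (y - s • b)) R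
        = c⁻¹ * ballAvg (fun y => ∫ s in Set.Ioi (0:ℝ),
            Real.exp (-c * s) * G (y - s • b)) R := by
      rw [ballAvg_eq, ballAvg_eq, integral_const_mul]; ring
    rw [this]
    gcongr
    exact ballAvg_integral_translate_le hG hc0 h0 hM b hK0 hR
      fun r hr => (hR₀ r (hRR.trans hr)).le
  have hcont : Tendsto (fun K => (c ^ 2)⁻¹ * K) (𝓝[>] L) (𝓝 ((c ^ 2)⁻¹ * L)) :=
    (continuous_const_mul _).continuousAt.mono_left nhdsWithin_le_nhds
  exact ge_of_tendsto hcont (eventually_mem_nhdsWithin.mono main)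

end BallAverage

/-- the Duhamel formula yields a bounded function solving the transport
equation `a(v)·∇_y f + Σ f = h` in the sense of distributions, preserving
(strict) positivity, with quadratic Besicovitch seminorm bounded by `S1⁻²` times
that of `h`. -/
theorem duhamel_solves_transport {d : ℕ} (V : Set (E d)) (hV : IsCompact V)
    (S : E d → E d → ℝ) (hSc : Continuous fun p : E d × E d => S p.1 p.2)
    (hSub : ∃ C : ℝ, ∀ y v, S y v ≤ C)
    (S1 : ℝ) (hS1 : 0 < S1) (hSlb : ∀ y v, S1 ≤ S y v)
    (a : E d → E d) (habd : ∃ C : ℝ, ∀ v, ‖a v‖ ≤ C)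
    (h : E d → E d → ℝ) (hhb : ∃ C : ℝ, ∀ y v, |h y v| ≤ C)
    (hhc : ∀ v, Continuous fun y => h y v) :
    (∃ C : ℝ, ∀ y v, |duhamel S a h y v| ≤ C) ∧
    ∀ v ∈ V,
      (∀ φ : E d → ℝ, ContDiff ℝ (⊤ : ℕ∞) φ → HasCompactSupport φ →
        ∫ y, (-(duhamel S a h y v) * fderiv ℝ φ y (a v)
            + S y v * duhamel S a h y v * φ y - h y v * φ y) = 0) ∧
      ((∀ y w, 0 ≤ h y w) → ∀ y, 0 ≤ duhamel S a h y v) ∧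
      ((∀ y w, 0 < h y w) → ∀ y, 0 < duhamel S a h y v) ∧
      limsup (fun R => ballAvg (fun y => (duhamel S a h y v) ^ 2) R) atTop ≤
        (S1 ^ 2)⁻¹ *
          limsup (fun R => ballAvg (fun y => (h y v) ^ 2) R) atTop := by
  obtain ⟨C, hC⟩ := hhb
  have hσ : ∀ v, Continuous fun y => S y v := fun v => hSc.comp (Continuous.prodMk_left v)
  simp only [duhamel_eq_charSol]
  refine ⟨⟨S1⁻¹ * C, fun y v => abs_charSol_le (hσ v) hS1 (fun y => hSlb y v)
    (fun y => hC y v) y⟩, fun v _ => ⟨fun φ hφ hφc => ?_, fun h0 => ?_, fun h0 => ?_, ?_⟩⟩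
  · exact integral_charSol_weak (hσ v) hS1 (fun y => hSlb y v) (hhc v) (fun y => hC y v)
      (hφ.of_le (by exact_mod_cast le_top)) hφc
  · exact charSol_nonneg fun y => h0 y v
  · exact charSol_pos (hσ v) hS1 (fun y => hSlb y v) (hhc v) (fun y => hC y v) fun y => h0 y v
  · exact limsup_ballAvg_le
      ((continuous_charSol (hσ v) hS1 (fun y => hSlb y v) (hhc v) fun y => hC y v).pow 2)
      (fun y => sq_nonneg _) ((hhc v).pow 2) hS1 (fun y => sq_nonneg _)
      (M := C ^ 2) (fun y => sq_le_sq' (abs_le.1 (hC y v)).1 (abs_le.1 (hC y v)).2) (a v)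
      (sq_charSol_le (hσ v) hS1 (fun y => hSlb y v) (hhc v) fun y => hC y v)
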